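/- arXiv:2603.27865 — 2 statements merged into one kernel-verified Lean document; each statement's English description precedes it below -/
import Mathlib

section
/- Let u ∈ S(ℝⁿ₊) be the restriction to the half-space ℝⁿ₊ = {xₙ > 0} of a Schwartz function, and let f(x', xₙ) = u(x', |xₙ|) be its even reflection. Then for s ∈ {0,1} and every real r ≥ 0, ‖f‖_{H^{s,r}(ℝⁿ)} ≤ √2 ‖u‖_{H^{s,r}(ℝⁿ₊)}; hence reflection extends to a bounded operator R : H^{s,r}(ℝⁿ₊) → H^{s,r}(ℝⁿ) with Ru = u on ℝⁿ₊ and norm ≤ √2. -/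
open MeasureTheory
open scoped ENNReal FourierTransform

noncomputable section

/-- |ξ'|² = sum of squares of the first n coordinates of ξ ∈ ℝ^{n+1}. -/
def tangSq {n : ℕ} (ξ : EuclideanSpace ℝ (Fin (n + 1))) : ℝ :=
  ∑ i : Fin n, ξ (Fin.castSucc i) ^ 2

/-- Squared H^{s,r}(ℝⁿ) norm: ∫ |û(ξ)|² (1+|ξ'|²)^r (1+|ξ|²)^s dξ. -/
def hsrNormSq {n : ℕ} (s r : ℝ) (u : EuclideanSpace ℝ (Fin (n + 1)) → ℂ) : ℝ≥0∞ :=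
  ∫⁻ ξ, (‖𝓕 u ξ‖₊ : ℝ≥0∞) ^ 2 *
    ENNReal.ofReal ((1 + tangSq ξ) ^ r * (1 + ‖ξ‖ ^ 2) ^ s)

/-- Even reflection: f(x', xₙ) = u(x', |xₙ|). -/
def reflectLast {n : ℕ} (u : EuclideanSpace ℝ (Fin (n + 1)) → ℂ)
    (x : EuclideanSpace ℝ (Fin (n + 1))) : ℂ :=
  u ((WithLp.equiv 2 (Fin (n + 1) → ℝ)).symm
    (Fin.snoc (fun i : Fin n => x (Fin.castSucc i)) |x (Fin.last n)|))

lemma aux_swap (φ : SchwartzMap ℝ ℂ) {F : ℝ → ℂ} (hF : Integrable F) :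
    ∫ x, (𝓕 φ) x * F x = ∫ x, φ x * 𝓕 F x := by
  have := VectorFourier.integral_bilin_fourierIntegral_eq_flip (ContinuousLinearMap.mul ℂ ℂ)
    (L := innerₗ ℝ) Real.continuous_fourierChar continuous_inner (φ.integrable (μ := volume)) hF
  simpa using! this

lemma aux_sq_lint (μ : Measure ℝ) (F : ℝ → ℂ) : ∫⁻ x, ‖F x‖ₑ ^ 2 ∂μ = eLpNorm F 2 μ ^ 2 := by
  rw [eLpNorm_eq_lintegral_rpow_enorm_toReal (by simp) (by simp)]
  simp only [ENNReal.toReal_ofNat, ENNReal.rpow_ofNat]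
  rw [← ENNReal.rpow_ofNat, ← ENNReal.rpow_mul]
  norm_num

lemma aux_planch {F : ℝ → ℂ} (hF : Integrable F) (hF2 : MemLp F 2) :
    ∫⁻ x, ‖𝓕 F x‖ₑ ^ 2 = ∫⁻ x, ‖F x‖ₑ ^ 2 := by
  set f : Lp ℂ 2 (volume : Measure ℝ) := hF2.toLp F with hf
  have hcont : Continuous (𝓕 F) :=
    VectorFourier.fourierIntegral_continuous Real.continuous_fourierChar
      (by exact continuous_inner) hF
  have hae : 𝓕 F =ᵐ[volume] (𝓕 f : Lp ℂ 2 (volume : Measure ℝ)) := by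
    refine ae_eq_of_integral_contDiff_smul_eq hcont.locallyIntegrable
      ((Lp.memLp _).locallyIntegrable (by norm_num)) ?_
    intro g hg hgc
    have hg1 : ContDiff ℝ (⊤ : ℕ∞) (fun x => (g x : ℂ)) := Complex.ofRealCLM.contDiff.comp hg
    have hg2 : HasCompactSupport (fun x => (g x : ℂ)) := hgc.comp_left (g := Complex.ofReal) rfl
    let φ : SchwartzMap ℝ ℂ := hg2.toSchwartzMap hg1
    have h1 := DFunLike.congr_fun (Lp.fourier_toTemperedDistribution_eq f) φ
    rw [Lp.toTemperedDistribution_apply, TemperedDistribution.fourier_apply,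
      Lp.toTemperedDistribution_apply] at h1
    have h2 := aux_swap φ hF
    have h3 : ∫ x, (𝓕 φ) x * F x = ∫ x, (𝓕 φ) x • f x := by
      refine integral_congr_ae ?_
      filter_upwards [hF2.coeFn_toLp] with x hx
      rw [hf, hx, smul_eq_mul]
    calc ∫ x, g x • 𝓕 F x = ∫ x, φ x * 𝓕 F x := by
          refine integral_congr_ae (.of_forall fun x => ?_)
          simp [φ]
      _ = ∫ x, φ x • (𝓕 f : Lp ℂ 2 (volume : Measure ℝ)) x := by rw [← h2, h3, h1]
      _ = _ := by
          refine integral_congr_ae (.of_forall fun x => ?_)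
          simp [φ]
  rw [aux_sq_lint, aux_sq_lint, eLpNorm_congr_ae hae]
  congr 1
  have := Lp.norm_fourier_eq f
  rw [Lp.norm_def, Lp.norm_def, ENNReal.toReal_eq_toReal_iff' (Lp.eLpNorm_ne_top _) (Lp.eLpNorm_ne_top _)] at this
  rw [this]
  exact eLpNorm_congr_ae hF2.coeFn_toLp

lemma aux_cs {f g : ℝ → ℝ≥0∞} (hf : AEMeasurable f) (hg : AEMeasurable g) :
    (∫⁻ x, f x * g x) ^ 2 ≤ (∫⁻ x, f x ^ 2) * ∫⁻ x, g x ^ 2 := by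
  have := ENNReal.lintegral_mul_le_Lp_mul_Lq volume Real.HolderConjugate.two_two hf hg
  refine (pow_le_pow_left' this 2).trans (le_of_eq ?_)
  simp only [ENNReal.rpow_ofNat, mul_pow]
  congr 1 <;> rw [← ENNReal.rpow_ofNat, ← ENNReal.rpow_mul] <;> norm_num

lemma aux_test (G : SchwartzMap ℝ ℂ) (B : ℝ≥0∞)
    (H : ∀ φ : SchwartzMap ℝ ℂ, (∀ x ≤ 0, φ x = 0) →
      ‖∫ x, φ x * G x‖ₑ ^ 2 ≤ (∫⁻ x, ‖φ x‖ₑ ^ 2) * B) :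
    ∫⁻ x in Set.Ioi 0, ‖G x‖ₑ ^ 2 ≤ B := by
  have key : ∀ a b : ℝ, 0 < a → a < b → ∫⁻ x in Set.Icc a b, ‖G x‖ₑ ^ 2 ≤ B := by
    intro a b ha hab
    let χ : ContDiffBump ((a + b) / 2 : ℝ) :=
      ⟨(b - a) / 2, b / 2, by linarith, by linarith⟩
    have hsm : ContDiff ℝ (⊤ : ℕ∞) (fun x => (χ x : ℂ) * (starRingEnd ℂ) (G x)) := by
      refine ContDiff.mul (Complex.ofRealCLM.contDiff.comp χ.contDiff) ?_
      exact Complex.conjCLE.contDiff.comp (G.smooth _)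
    have hcs : HasCompactSupport (fun x => (χ x : ℂ) * (starRingEnd ℂ) (G x)) :=
      (χ.hasCompactSupport.comp_left (g := Complex.ofReal) rfl).mul_right
    let φ : SchwartzMap ℝ ℂ := hcs.toSchwartzMap hsm
    have hφ : ∀ x, φ x = (χ x : ℂ) * (starRingEnd ℂ) (G x) := fun x => rfl
    have h0 : ∀ x ≤ 0, φ x = 0 := by
      intro x hx
      rw [hφ, χ.zero_of_le_dist]
      · simp
      · rw [Real.dist_eq, abs_of_nonpos (by linarith)]
        show b / 2 ≤ _
        linarith
    have h1 := H φ h0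
    have hint : Integrable (fun x => χ x * ‖G x‖ ^ 2) := by
      refine Continuous.integrable_of_hasCompactSupport (by have := χ.continuous; have := G.continuous; fun_prop) ?_
      exact χ.hasCompactSupport.mul_right
    have h2 : ∫ x, φ x * G x = ((∫ x, χ x * ‖G x‖ ^ 2 : ℝ) : ℂ) := by
      rw [← integral_complex_ofReal]
      refine integral_congr_ae (.of_forall fun x => ?_)
      simp only [hφ]
      rw [mul_assoc, mul_comm ((starRingEnd ℂ) (G x)), Complex.mul_conj, Complex.normSq_eq_norm_sq]
      push_cast; ring
    set X := ∫⁻ x, ENNReal.ofReal (χ x * ‖G x‖ ^ 2) with hX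
    have hXr : ‖∫ x, φ x * G x‖ₑ = X := by
      rw [h2, hX, ← ofReal_integral_eq_lintegral_ofReal hint
        (.of_forall fun x => mul_nonneg χ.nonneg (by positivity)), ← ofReal_norm, Complex.norm_real,
        Real.norm_of_nonneg (integral_nonneg fun x => mul_nonneg χ.nonneg (by positivity))]
    have hXt : X ≠ ⊤ := by rw [← hXr]; simp
    have h3 : ∫⁻ x, ‖φ x‖ₑ ^ 2 ≤ X := by
      refine lintegral_mono fun x => ?_
      rw [← ofReal_norm, ← ENNReal.ofReal_pow (norm_nonneg _)]
      refine ENNReal.ofReal_le_ofReal ?_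
      rw [hφ, norm_mul, RCLike.norm_conj, Complex.norm_real, Real.norm_of_nonneg χ.nonneg, mul_pow]
      gcongr
      nlinarith [χ.nonneg (x := x), χ.le_one (x := x)]
    have h4 : X ≤ B := by
      rw [hXr] at h1
      rcases eq_or_ne X 0 with h | h
      · rw [h]; exact zero_le
      · have : X * X ≤ X * B := by rw [← sq]; exact h1.trans (by gcongr)
        exact (ENNReal.mul_le_mul_iff_right h hXt).1 this
    refine le_trans ?_ h4
    rw [← lintegral_indicator measurableSet_Icc]
    refine lintegral_mono fun x => ?_
    refine Set.indicator_apply_le' (fun hx => ?_) fun _ => zero_le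
    rw [χ.one_of_mem_closedBall, one_mul, ENNReal.ofReal_pow (norm_nonneg _), ofReal_norm]
    rw [Metric.mem_closedBall, Real.dist_eq, abs_le]
    show -((b - a) / 2) ≤ _ ∧ _ ≤ (b - a) / 2
    constructor <;> linarith [hx.1, hx.2]
  have hc : AECover (volume.restrict (Set.Ioi (0 : ℝ))) Filter.atTop
      (fun k : ℕ => Set.Icc (1 / ((k : ℝ) + 1)) ((k : ℝ) + 2)) :=
    (aecover_Ioi_of_Ici (A := (0 : ℝ)) (a := fun k : ℕ => 1 / ((k : ℝ) + 1))
      tendsto_one_div_add_atTop_nhds_zero_nat).inter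
    (aecover_Iic (b := fun k : ℕ => (k : ℝ) + 2)
      (Filter.tendsto_atTop_add_const_right _ _ tendsto_natCast_atTop_atTop))
  have ht := hc.lintegral_tendsto_of_nat (f := fun x => ‖G x‖ₑ ^ 2)
    (by have := G.continuous; fun_prop)
  refine le_of_tendsto' ht fun k => ?_
  refine (lintegral_mono' (Measure.restrict_mono le_rfl Measure.restrict_le_self) le_rfl).trans
    (key _ _ (by positivity) ?_)
  have : 1 / ((k : ℝ) + 1) ≤ 1 := by
    rw [div_le_one (by positivity)]; linarith [(Nat.cast_nonneg k : (0:ℝ) ≤ k)]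
  linarith [(Nat.cast_nonneg k : (0:ℝ) ≤ k)]

lemma aux_test0 (U : SchwartzMap ℝ ℂ) {V : ℝ → ℂ} (hV : Integrable V)
    (hUV : ∀ t, 0 < t → V t = U t) :
    ∫⁻ x in Set.Ioi 0, ‖U x‖ₑ ^ 2 ≤ ∫⁻ x, ‖𝓕 V x‖ₑ ^ 2 := by
  have hcont : Continuous (𝓕 V) :=
    VectorFourier.fourierIntegral_continuous Real.continuous_fourierChar
      (by exact continuous_inner) hV
  refine aux_test U _ fun φ hφ => ?_
  have e1 : ∫ x, φ x * U x = ∫ x, φ x * V x := by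
    congr 1; ext x
    rcases le_or_gt x 0 with hx | hx
    · simp [hφ x hx]
    · rw [hUV x hx]
  set ψ : SchwartzMap ℝ ℂ := 𝓕⁻ φ with hψ
  have e2 : φ = 𝓕 ψ := by simp [hψ]
  have e3 : ∫⁻ x, ‖φ x‖ₑ ^ 2 = ∫⁻ x, ‖ψ x‖ₑ ^ 2 := by
    have := aux_planch ψ.integrable (ψ.memLp 2 _)
    rw [← this, e2]; rfl
  rw [e1, e3]
  nth_rewrite 1 [e2]
  rw [aux_swap ψ hV]
  calc _ ≤ (∫⁻ x, ‖ψ x‖ₑ * ‖𝓕 V x‖ₑ) ^ 2 := by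
        gcongr
        refine (enorm_integral_le_lintegral_enorm _).trans (le_of_eq ?_)
        simp only [enorm_mul]
    _ ≤ _ := aux_cs (by have := ψ.continuous; fun_prop) (by fun_prop)

lemma aux_test1 (U : SchwartzMap ℝ ℂ) {V : ℝ → ℂ} (hV : Integrable V)
    (hUV : ∀ t, 0 < t → V t = U t) :
    ∫⁻ x in Set.Ioi 0, ‖SchwartzMap.derivCLM ℂ ℂ U x‖ₑ ^ 2 ≤
      ∫⁻ x : ℝ, (‖(2 * Real.pi * Complex.I * x : ℂ)‖ₑ * ‖𝓕 V x‖ₑ) ^ 2 := by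
  have hcont : Continuous (𝓕 V) :=
    VectorFourier.fourierIntegral_continuous Real.continuous_fourierChar
      (by exact continuous_inner) hV
  refine aux_test _ _ fun φ hφ => ?_
  set ψ : SchwartzMap ℝ ℂ := 𝓕⁻ φ with hψ
  have e2 : φ = 𝓕 ψ := by simp [hψ]
  have e3 : ∫⁻ x, ‖φ x‖ₑ ^ 2 = ∫⁻ x, ‖ψ x‖ₑ ^ 2 := by
    have := aux_planch ψ.integrable (ψ.memLp 2 _)
    rw [← this, e2]; rfl
  have e1 : ∫ x, φ x * SchwartzMap.derivCLM ℂ ℂ U x = - ∫ x, deriv φ x * V x := by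
    simp only [SchwartzMap.derivCLM_apply]
    rw [SchwartzMap.integral_mul_deriv_eq_neg_deriv_mul]
    congr 1
    refine integral_congr_ae ?_
    filter_upwards [compl_mem_ae_iff.2 (measure_singleton (0 : ℝ))] with x hx
    rcases lt_or_gt_of_ne (show x ≠ 0 from hx) with h | h
    · have : deriv φ x = 0 := by
        have : φ =ᶠ[nhds x] fun _ => 0 := by
          filter_upwards [Iio_mem_nhds h] with y hy using hφ y hy.le
        rw [this.deriv_eq]; simp
      simp [this]
    · rw [hUV x h]
  have e4 : ∀ x, deriv φ x = 𝓕 (-(2 * Real.pi * Complex.I) •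
      SchwartzMap.smulLeftCLM ℂ (fun x : ℝ => inner ℝ x (1 : ℝ)) ψ) x := by
    intro x
    rw [← SchwartzMap.lineDerivOp_fourier_eq, ← e2]
    rfl
  rw [e1, e3]
  simp only [e4]
  rw [aux_swap _ hV, enorm_neg]
  have hg : (fun x : ℝ => inner ℝ x (1 : ℝ)).HasTemperateGrowth := by fun_prop
  calc _ ≤ (∫⁻ x, ‖ψ x‖ₑ * (‖(2 * Real.pi * Complex.I * x : ℂ)‖ₑ * ‖𝓕 V x‖ₑ)) ^ 2 := by
        gcongr
        refine (enorm_integral_le_lintegral_enorm _).trans (le_of_eq ?_)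
        refine lintegral_congr fun x => ?_
        simp only [smul_apply, SchwartzMap.smulLeftCLM_apply_apply hg, ← enorm_mul]
        rw [← enorm_neg]
        congr 1
        simp
        ring
    _ ≤ _ := aux_cs (by have := ψ.continuous; fun_prop) (by fun_prop)

/-- Extension of `G` from the half line with sign `c`. -/
def auxRef (c : ℂ) (G : ℝ → ℂ) (t : ℝ) : ℂ := if 0 < t then G t else c * G (-t)

lemma auxRef_eq (c : ℂ) (G : ℝ → ℂ) :
    auxRef c G = (Set.Ioi 0).piecewise G (fun t => c * G (-t)) := by
  ext t; simp [auxRef, Set.piecewise]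

lemma auxRef_int (c : ℂ) (G : SchwartzMap ℝ ℂ) : Integrable (auxRef c G) := by
  rw [auxRef_eq]
  exact Integrable.piecewise measurableSet_Ioi G.integrable.integrableOn
    ((G.integrable.comp_neg).const_mul c).integrableOn

lemma auxRef_lint (c : ℂ) (hc : ‖c‖ₑ = 1) (G : SchwartzMap ℝ ℂ) :
    ∫⁻ t, ‖auxRef c G t‖ₑ ^ 2 = 2 * ∫⁻ t in Set.Ioi 0, ‖G t‖ₑ ^ 2 := by
  rw [← lintegral_add_compl _ (measurableSet_Ioi (a := (0 : ℝ))), two_mul]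
  congr 1
  · refine setLIntegral_congr_fun measurableSet_Ioi fun t ht => ?_
    simp only [auxRef, if_pos (show 0 < t from ht)]
  · have h := (Measure.measurePreserving_neg (volume : Measure ℝ)).setLIntegral_comp_preimage
      (s := Set.Ici 0) measurableSet_Ici (f := fun t => ‖G t‖ₑ ^ 2)
      (by have := G.continuous; fun_prop)
    rw [setLIntegral_congr Ioi_ae_eq_Ici, ← h]
    have hs : (Set.Ioi (0 : ℝ))ᶜ = Neg.neg ⁻¹' Set.Ici 0 := by ext; simp
    rw [hs]
    refine setLIntegral_congr_fun (by rw [← hs]; exact measurableSet_Ioi.compl) fun t ht => ?_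
    have : ¬ 0 < t := by simpa using ht
    simp only [auxRef, if_neg this, enorm_mul, hc, one_mul]

lemma auxRef_memLp (c : ℂ) (hc : ‖c‖ₑ = 1) (G : SchwartzMap ℝ ℂ) : MemLp (auxRef c G) 2 := by
  refine ⟨(auxRef_int c G).aestronglyMeasurable, ?_⟩
  have h := auxRef_lint c hc G
  rw [aux_sq_lint, aux_sq_lint] at h
  have h2 : eLpNorm G 2 (volume.restrict (Set.Ioi 0)) < ⊤ :=
    (G.memLp 2 volume).restrict _ |>.2
  have : eLpNorm (auxRef c G) 2 volume ^ 2 < ⊤ := by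
    rw [h]; exact ENNReal.mul_lt_top (by simp) (ENNReal.pow_lt_top h2)
  by_contra hcon
  simp only [not_lt, top_le_iff] at hcon
  simp [hcon] at this

lemma auxRef_planch (c : ℂ) (hc : ‖c‖ₑ = 1) (G : SchwartzMap ℝ ℂ) :
    ∫⁻ t, ‖𝓕 (auxRef c G) t‖ₑ ^ 2 = 2 * ∫⁻ t in Set.Ioi 0, ‖G t‖ₑ ^ 2 := by
  rw [aux_planch (auxRef_int c G) (auxRef_memLp c hc G), auxRef_lint c hc]

lemma auxRef_one (U : ℝ → ℂ) (t : ℝ) : auxRef 1 U t = U |t| := by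
  unfold auxRef
  split_ifs with h
  · rw [abs_of_pos h]
  · rw [abs_of_nonpos (not_lt.1 h), one_mul]

lemma auxRef_deriv (U : SchwartzMap ℝ ℂ) (τ : ℝ) :
    𝓕 (auxRef (-1) (SchwartzMap.derivCLM ℂ ℂ U)) τ =
      (2 * Real.pi * Complex.I * τ) * 𝓕 (auxRef 1 U) τ := by
  set F := auxRef 1 U with hF
  set F' := auxRef (-1) (SchwartzMap.derivCLM ℂ ℂ U) with hF'
  have hFc : Continuous F := by
    have : F = fun t => U |t| := funext (auxRef_one U)
    rw [this]
    exact U.continuous.comp continuous_abs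
  let e : ℝ → ℂ := fun t => Complex.exp (-(2 * Real.pi * Complex.I * τ) * t)
  have he : ∀ t, HasDerivAt e (-(2 * Real.pi * Complex.I * τ) * e t) t := by
    intro t
    have h := ((Complex.ofRealCLM.hasDerivAt (x := t)).const_mul
      (-(2 * Real.pi * Complex.I * τ))).cexp
    convert! h using 1
    simp [e]
    ring
  have hen : ∀ t, ‖e t‖ = 1 := by
    intro t
    have : e t = Complex.exp ((-(2 * Real.pi * τ * t) : ℝ) * Complex.I) := by
      simp only [e]; congr 1; push_cast; ring
    rw [this, Complex.norm_exp_ofReal_mul_I]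
  have hec : Continuous e := by fun_prop
  have hft : ∀ g : ℝ → ℂ, 𝓕 g τ = ∫ t, e t * g t := by
    intro g
    rw [Real.fourier_real_eq_integral_exp_smul]
    refine integral_congr_ae (.of_forall fun t => ?_)
    simp only [e, smul_eq_mul]
    congr 2
    push_cast; ring
  have hder : ∀ t, t ≠ 0 → HasDerivAt F (F' t) t := by
    intro t ht
    rcases lt_or_gt_of_ne ht with h | h
    · have h1 : F =ᶠ[nhds t] fun s => U (-s) := by
        filter_upwards [Iio_mem_nhds h] with s hs
        rw [hF, auxRef_one, abs_of_neg hs]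
      have h2 : HasDerivAt (fun s => U (-s)) (F' t) t := by
        have h3 := (U.differentiableAt (x := -t)).hasDerivAt.scomp t (hasDerivAt_neg t)
        convert! h3 using 1
        simp [hF', auxRef, not_lt.2 h.le]
      exact h2.congr_of_eventuallyEq h1
    · have h1 : F =ᶠ[nhds t] U := by
        filter_upwards [Ioi_mem_nhds h] with s hs
        rw [hF, auxRef_one, abs_of_pos hs]
      have h2 : HasDerivAt U (F' t) t := by
        convert! (U.differentiableAt (x := t)).hasDerivAt using 1
        simp [hF', auxRef, h]
      exact h2.congr_of_eventuallyEq h1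
  let h : ℝ → ℂ := fun t => e t * F t
  let h' : ℝ → ℂ := fun t => -(2 * Real.pi * Complex.I * τ) * e t * F t + e t * F' t
  have hh : ∀ t, t ≠ 0 → HasDerivAt h (h' t) t := fun t ht => (he t).mul (hder t ht)
  have hb : ∀ g : ℝ → ℂ, Integrable g → Integrable (fun t => e t * g t) := by
    intro g hg
    exact hg.bdd_mul hec.aestronglyMeasurable (.of_forall fun t => (hen t).le)
  have i1 : Integrable (fun t => e t * F t) := hb _ (auxRef_int _ _)
  have i2 : Integrable (fun t => e t * F' t) := hb _ (auxRef_int _ _)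
  have i3 : Integrable h' := by
    refine Integrable.add ?_ i2
    simpa only [mul_assoc] using i1.const_mul (-(2 * Real.pi * Complex.I * τ))
  have hlim : Filter.Tendsto h (Filter.cocompact ℝ) (nhds 0) := by
    rw [tendsto_zero_iff_norm_tendsto_zero]
    have h1 := (tendsto_zero_iff_norm_tendsto_zero.1 U.tendsto_cocompact).comp
      (show Filter.Tendsto (fun t : ℝ => |t|) (Filter.cocompact ℝ) (Filter.cocompact ℝ) from
        (tendsto_norm_cocompact_atTop (E := ℝ)).mono_right atTop_le_cocompact)
    refine h1.congr fun t => ?_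
    simp only [h, norm_mul, hen, one_mul, hF, auxRef_one, Function.comp]
  have hhc : Continuous h := hec.mul hFc
  have s1 := integral_Ioi_of_hasDerivAt_of_tendsto (a := 0) hhc.continuousWithinAt
    (fun x hx => hh x (ne_of_gt hx)) i3.integrableOn (hlim.mono_left atTop_le_cocompact)
  have s2 := integral_Iic_of_hasDerivAt_of_tendsto (a := 0) hhc.continuousWithinAt
    (fun x hx => hh x (ne_of_lt hx)) i3.integrableOn (hlim.mono_left atBot_le_cocompact)
  have s3 : ∫ t, h' t = 0 := by
    rw [← intervalIntegral.integral_Iic_add_Ioi (b := 0) i3.integrableOn i3.integrableOn, s1, s2]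
    ring
  have s4 : ∫ t, h' t = -(2 * Real.pi * Complex.I * τ) * (∫ t, e t * F t) + ∫ t, e t * F' t := by
    rw [← integral_const_mul, ← integral_add (i1.const_mul _) i2]
    simp only [h', mul_assoc]
  rw [hft, hft]
  rw [s3] at s4
  linear_combination -s4

lemma aux_line (U : SchwartzMap ℝ ℂ) {V : ℝ → ℂ} (hV : Integrable V)
    (hUV : ∀ t, 0 < t → V t = U t) :
    ∫⁻ x, ‖𝓕 (fun t => U |t|) x‖ₑ ^ 2 ≤ 2 * ∫⁻ x, ‖𝓕 V x‖ₑ ^ 2 := by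
  have : (fun t => U |t|) = auxRef 1 U := (funext (auxRef_one U)).symm
  rw [this, auxRef_planch 1 (by simp)]
  exact mul_le_mul_right (aux_test0 U hV hUV) 2

lemma aux_line_deriv (U : SchwartzMap ℝ ℂ) {V : ℝ → ℂ} (hV : Integrable V)
    (hUV : ∀ t, 0 < t → V t = U t) :
    ∫⁻ x, ‖𝓕 (fun t => U |t|) x‖ₑ ^ 2 * ENNReal.ofReal (x ^ 2) ≤
      2 * ∫⁻ x, ‖𝓕 V x‖ₑ ^ 2 * ENNReal.ofReal (x ^ 2) := by
  have : (fun t => U |t|) = auxRef 1 U := (funext (auxRef_one U)).symm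
  have h1 := auxRef_planch (-1) (by simp) (SchwartzMap.derivCLM ℂ ℂ U)
  have h2 := aux_test1 U hV hUV
  have key : ∀ W : ℝ → ℂ, ∫⁻ x : ℝ, (‖(2 * Real.pi * Complex.I * x : ℂ)‖ₑ * ‖W x‖ₑ) ^ 2 =
      ENNReal.ofReal ((2 * Real.pi) ^ 2) * ∫⁻ x, ‖W x‖ₑ ^ 2 * ENNReal.ofReal (x ^ 2) := by
    intro W
    rw [← lintegral_const_mul' _ _ ENNReal.ofReal_ne_top]
    refine lintegral_congr fun x => ?_
    have : ‖(2 * Real.pi * Complex.I * x : ℂ)‖ₑ ^ 2 =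
        ENNReal.ofReal ((2 * Real.pi) ^ 2) * ENNReal.ofReal (x ^ 2) := by
      rw [← ofReal_norm, ← ENNReal.ofReal_pow (norm_nonneg _), ← ENNReal.ofReal_mul (by positivity)]
      congr 1
      simp [mul_pow]
    rw [mul_pow, this]; ring
  have h0 : ∫⁻ x : ℝ, (‖(2 * Real.pi * Complex.I * x : ℂ)‖ₑ * ‖𝓕 (auxRef 1 U) x‖ₑ) ^ 2 =
      ∫⁻ x, ‖𝓕 (auxRef (-1) (SchwartzMap.derivCLM ℂ ℂ U)) x‖ₑ ^ 2 :=
    lintegral_congr fun x => by rw [auxRef_deriv, ← enorm_mul]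
  rw [← h0, key] at h1
  rw [key] at h2
  rw [this]
  refine (ENNReal.mul_le_mul_iff_right (a := ENNReal.ofReal ((2 * Real.pi) ^ 2)) ?_ ENNReal.ofReal_ne_top).1 ?_
  · simp
  · rw [h1, mul_left_comm]
    exact mul_le_mul_right h2 2

lemma aux_line_weighted (s : ℝ) (hs : s = 0 ∨ s = 1) (A : ℝ) (hA : 0 ≤ A) (U : SchwartzMap ℝ ℂ) {V : ℝ → ℂ}
    (hV : Integrable V) (hUV : ∀ t, 0 < t → V t = U t) :
    ∫⁻ x, ‖𝓕 (fun t => U |t|) x‖ₑ ^ 2 * ENNReal.ofReal ((A + x ^ 2) ^ s) ≤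
      2 * ∫⁻ x, ‖𝓕 V x‖ₑ ^ 2 * ENNReal.ofReal ((A + x ^ 2) ^ s) := by
  rcases hs with rfl | rfl
  · simpa using aux_line U hV hUV
  · have hc : ∀ W : ℝ → ℂ, Integrable W → Continuous (𝓕 W) := fun W hW =>
      VectorFourier.fourierIntegral_continuous Real.continuous_fourierChar
        (by exact continuous_inner) hW
    have key : ∀ W : ℝ → ℂ, Integrable W →
        ∫⁻ x, ‖𝓕 W x‖ₑ ^ 2 * ENNReal.ofReal ((A + x ^ 2) ^ (1 : ℝ)) =
        ENNReal.ofReal A * (∫⁻ x, ‖𝓕 W x‖ₑ ^ 2) +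
          ∫⁻ x, ‖𝓕 W x‖ₑ ^ 2 * ENNReal.ofReal (x ^ 2) := by
      intro W hW
      have := hc W hW
      rw [← lintegral_const_mul' _ _ ENNReal.ofReal_ne_top, ← lintegral_add_left (by fun_prop)]
      refine lintegral_congr fun x => ?_
      rw [Real.rpow_one, ENNReal.ofReal_add hA (by positivity)]; ring
    have hU : Integrable (fun t => U |t|) := by
      have : (fun t => U |t|) = auxRef 1 U := (funext (auxRef_one U)).symm
      rw [this]; exact auxRef_int _ _
    rw [key _ hU, key _ hV, mul_add, mul_left_comm]
    exact add_le_add (by gcongr; exact aux_line U hV hUV) (aux_line_deriv U hV hUV)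

/-- The splitting `(t, y) ↦ (y, t)` of `ℝ^{n+1}`. -/
def auxJ (n : ℕ) : ℝ × (Fin n → ℝ) ≃ᵐ EuclideanSpace ℝ (Fin (n + 1)) :=
  (MeasurableEquiv.piFinSuccAbove (fun _ : Fin (n + 1) => ℝ) (Fin.last n)).symm.trans
    (MeasurableEquiv.toLp 2 (Fin (n + 1) → ℝ))

lemma auxJ_eq {n : ℕ} (p : ℝ × (Fin n → ℝ)) :
    auxJ n p = WithLp.toLp 2 (Fin.snoc (α := fun _ => ℝ) p.2 p.1) := by
  rw [← Fin.insertNth_last']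
  rfl

@[simp] lemma auxJ_last {n : ℕ} (p : ℝ × (Fin n → ℝ)) : auxJ n p (Fin.last n) = p.1 := by
  rw [auxJ_eq]; simp

@[simp] lemma auxJ_castSucc {n : ℕ} (p : ℝ × (Fin n → ℝ)) (i : Fin n) :
    auxJ n p (Fin.castSucc i) = p.2 i := by
  rw [auxJ_eq]; simp

lemma auxJ_mp (n : ℕ) : MeasurePreserving (auxJ n) volume volume := by
  have h1 := (volume_preserving_piFinSuccAbove (fun _ : Fin (n + 1) => ℝ) (Fin.last n)).symm
  exact (EuclideanSpace.volume_preserving_symm_measurableEquiv_toLp (Fin (n + 1))).symm.comp h1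

lemma auxJ_inner {n : ℕ} (p q : ℝ × (Fin n → ℝ)) :
    inner ℝ (auxJ n p) (auxJ n q) = p.1 * q.1 + ∑ i, p.2 i * q.2 i := by
  rw [PiLp.inner_apply, Fin.sum_univ_castSucc]
  simp [mul_comm, add_comm]

lemma auxJ_normsq {n : ℕ} (p : ℝ × (Fin n → ℝ)) :
    ‖auxJ n p‖ ^ 2 = p.1 ^ 2 + ∑ i, p.2 i ^ 2 := by
  rw [← real_inner_self_eq_norm_sq, auxJ_inner]
  simp [sq]

lemma auxJ_tang {n : ℕ} (p : ℝ × (Fin n → ℝ)) : tangSq (auxJ n p) = ∑ i, p.2 i ^ 2 := by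
  simp [tangSq]

lemma auxJ_norm {n : ℕ} (p : ℝ × (Fin n → ℝ)) : ‖p.2‖ ≤ ‖auxJ n p‖ := by
  rw [pi_norm_le_iff_of_nonneg (norm_nonneg _)]
  intro i
  rw [← auxJ_castSucc]
  exact PiLp.norm_apply_le _ _

lemma auxJ_cont (n : ℕ) : Continuous (auxJ n) := by
  have : ⇑(auxJ n) = fun p => WithLp.toLp 2 (Fin.snoc (α := fun _ => ℝ) p.2 p.1) :=
    funext auxJ_eq
  rw [this]
  refine (PiLp.continuous_toLp 2 _).comp (continuous_pi fun i => ?_)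
  refine Fin.lastCases ?_ (fun i => ?_) i
  · simpa using continuous_fst
  · simpa [Function.comp_def] using (continuous_apply i).comp continuous_snd

lemma auxJ_reflect {n : ℕ} (u : EuclideanSpace ℝ (Fin (n + 1)) → ℂ) (p : ℝ × (Fin n → ℝ)) :
    reflectLast u (auxJ n p) = u (auxJ n (|p.1|, p.2)) := by
  unfold reflectLast
  congr 1
  rw [auxJ_eq (|p.1|, p.2)]
  simp

/-- Partial Fourier transform in the tangential variables. -/
def auxP {n : ℕ} (g : EuclideanSpace ℝ (Fin (n + 1)) → ℂ) (η : Fin n → ℝ) (t : ℝ) : ℂ :=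
  ∫ y : Fin n → ℝ, (Real.fourierChar (-(∑ i, y i * η i)) : ℂ) * g (auxJ n (t, y))

lemma auxP_main {n : ℕ} {g : EuclideanSpace ℝ (Fin (n + 1)) → ℂ} (hg : Integrable g)
    (η : Fin n → ℝ) :
    Integrable (auxP g η) ∧ ∀ τ, 𝓕 g (auxJ n (τ, η)) = 𝓕 (auxP g η) τ := by
  have h1 : Integrable (fun p => g (auxJ n p)) :=
    ((auxJ_mp n).integrable_comp_emb (auxJ n).measurableEmbedding).2 hg
  have h2 : ∀ k : ℝ × (Fin n → ℝ) → ℝ, Continuous k →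
      Integrable (fun p => (Real.fourierChar (k p) : ℂ) * g (auxJ n p)) := by
    intro k hk
    refine h1.bdd_mul (c := 1) ?_ (.of_forall fun p => (Circle.norm_coe _).le)
    exact (continuous_subtype_val.comp
      (Real.continuous_fourierChar.comp hk)).aestronglyMeasurable
  constructor
  · have := h2 (fun p => -(∑ i, p.2 i * η i)) (by fun_prop)
    rw [Measure.volume_eq_prod] at this
    exact this.integral_prod_left
  · intro τ
    rw [Real.fourier_eq, Real.fourier_eq,
      ← (auxJ_mp n).integral_comp (auxJ n).measurableEmbedding]
    have h3 := h2 (fun p => -(p.1 * τ + ∑ i, p.2 i * η i)) (by fun_prop)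
    simp only [auxJ_inner, Circle.smul_def, smul_eq_mul]
    rw [Measure.volume_eq_prod] at h3 ⊢
    rw [integral_prod _ h3]
    refine integral_congr_ae (.of_forall fun t => ?_)
    simp only [auxP]
    rw [← integral_const_mul]
    refine integral_congr_ae (.of_forall fun y => ?_)
    simp only [neg_add, AddChar.map_add_eq_mul, Circle.coe_mul]
    simp [mul_comm, mul_assoc]

lemma aux_decay {n : ℕ} (u : SchwartzMap (EuclideanSpace ℝ (Fin (n + 1))) ℂ) :
    ∃ C : ℝ, ∀ x, ‖u x‖ ≤ C * (1 + ‖x‖) ^ (-((n + 2 : ℕ) : ℝ)) := by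
  refine ⟨2 ^ (n + 2) * (((Finset.Iic (n + 2, 0)).sup fun m : ℕ × ℕ =>
    SchwartzMap.seminorm ℝ m.1 m.2) u), fun x => ?_⟩
  have h := SchwartzMap.one_add_le_sup_seminorm_apply (𝕜 := ℝ) (m := (n + 2, 0)) (le_refl (n + 2))
    (le_refl 0) u x
  rw [norm_iteratedFDeriv_zero] at h
  rw [Real.rpow_neg (by positivity), Real.rpow_natCast, ← div_eq_mul_inv,
    le_div_iff₀ (by positivity), mul_comm]
  exact h

lemma aux_reflect_int {n : ℕ} (u : SchwartzMap (EuclideanSpace ℝ (Fin (n + 1))) ℂ) :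
    Integrable (reflectLast (fun x => u x)) := by
  obtain ⟨C, hC⟩ := aux_decay u
  have hcomp : reflectLast (fun x => u x) = fun x =>
      u (auxJ n (|((auxJ n).symm x).1|, ((auxJ n).symm x).2)) := by
    ext x
    conv_lhs => rw [← (auxJ n).apply_symm_apply x]
    exact auxJ_reflect _ _
  have hI : Integrable (fun x : EuclideanSpace ℝ (Fin (n + 1)) =>
      C * (1 + ‖x‖) ^ (-((n + 2 : ℕ) : ℝ))) := by
    refine Integrable.const_mul (integrable_one_add_norm ?_) C
    simp
  refine hI.mono' ?_ (.of_forall fun x => ?_)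
  · rw [hcomp]
    refine (u.continuous.measurable.comp ?_).aestronglyMeasurable
    fun_prop
  · rw [hcomp]
    refine (hC _).trans (le_of_eq ?_)
    have : ‖auxJ n (|((auxJ n).symm x).1|, ((auxJ n).symm x).2)‖ = ‖x‖ := by
      rw [← sq_eq_sq₀ (norm_nonneg _) (norm_nonneg _), auxJ_normsq]
      conv_rhs => rw [← (auxJ n).apply_symm_apply x, auxJ_normsq]
      simp
    rw [this]

lemma auxP_cont {n : ℕ} (u : SchwartzMap (EuclideanSpace ℝ (Fin (n + 1))) ℂ) (η : Fin n → ℝ) :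
    Continuous (auxP u η) := by
  obtain ⟨C, hC⟩ := aux_decay u
  have hC0 : 0 ≤ C := by
    have := (norm_nonneg _).trans (hC 0)
    simpa using this
  have hcont : Continuous fun p : ℝ × (Fin n → ℝ) =>
      (Real.fourierChar (-(∑ i, p.2 i * η i)) : ℂ) * u (auxJ n p) := by
    refine Continuous.mul ?_ (u.continuous.comp (auxJ_cont n))
    exact continuous_subtype_val.comp (Real.continuous_fourierChar.comp (by fun_prop))
  refine continuous_of_dominated (bound := fun y => C * (1 + ‖y‖) ^ (-((n + 2 : ℕ) : ℝ)))
    (fun t => ?_) (fun t => .of_forall fun y => ?_) ?_ (.of_forall fun y => ?_)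
  · exact (hcont.comp (Continuous.prodMk_right t)).aestronglyMeasurable
  · rw [norm_mul, Circle.norm_coe, one_mul]
    refine (hC _).trans ?_
    refine mul_le_mul_of_nonneg_left ?_ hC0
    refine Real.rpow_le_rpow_of_nonpos (by positivity) ?_ (neg_nonpos.2 (Nat.cast_nonneg _))
    have := auxJ_norm (t, y)
    simp only at this
    linarith
  · refine Integrable.const_mul (integrable_one_add_norm ?_) C
    simp
  · exact hcont.comp (g := fun p : ℝ × (Fin n → ℝ) =>
      (Real.fourierChar (-(∑ i, p.2 i * η i)) : ℂ) * u (auxJ n p))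
      (f := fun t : ℝ => (t, y)) (by fun_prop)

lemma auxP_schwartz {n : ℕ} (u : SchwartzMap (EuclideanSpace ℝ (Fin (n + 1))) ℂ)
    (η : Fin n → ℝ) : ∃ U : SchwartzMap ℝ ℂ, ∀ t, auxP u η t = U t := by
  have hJ : (fun τ : ℝ => auxJ n (τ, η)) =
      fun τ => auxJ n (0, η) + τ • EuclideanSpace.single (Fin.last n) (1 : ℝ) := by
    ext τ i
    refine Fin.lastCases ?_ (fun i => ?_) i
    · simp
    · simp
  have hg : (fun τ : ℝ => auxJ n (τ, η)).HasTemperateGrowth := by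
    rw [hJ]; fun_prop
  have hiso : Isometry (fun τ : ℝ => auxJ n (τ, η)) := by
    rw [hJ]
    refine Isometry.of_dist_eq fun a b => ?_
    rw [dist_add_left, dist_eq_norm, ← sub_smul, norm_smul]
    simp [Real.dist_eq]
  let W : SchwartzMap ℝ ℂ := SchwartzMap.compCLMOfAntilipschitz ℂ hg hiso.antilipschitz (𝓕 u)
  obtain ⟨hi, hf⟩ := auxP_main u.integrable η
  have hW : 𝓕 (auxP u η) = W := by
    ext τ
    rw [← hf]
    rfl
  have hinv := (auxP_cont u η).fourierInv_fourier_eq hi (by rw [hW]; exact W.integrable)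
  refine ⟨𝓕⁻ W, fun t => ?_⟩
  rw [SchwartzMap.fourierInv_coe, ← hW, hinv]

lemma aux_norm_eq {n : ℕ} (s r : ℝ) {g : EuclideanSpace ℝ (Fin (n + 1)) → ℂ} (hg : Integrable g) :
    hsrNormSq s r g = ∫⁻ η : Fin n → ℝ, ENNReal.ofReal ((1 + ∑ i, η i ^ 2) ^ r) *
      ∫⁻ τ : ℝ, ‖𝓕 (auxP g η) τ‖ₑ ^ 2 *
        ENNReal.ofReal (((1 + ∑ i, η i ^ 2) + τ ^ 2) ^ s) := by
  have hc : Continuous (𝓕 g) :=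
    VectorFourier.fourierIntegral_continuous Real.continuous_fourierChar
      (by exact continuous_inner) hg
  have hc2 : Measurable fun p => 𝓕 g (auxJ n p) := hc.measurable.comp (auxJ n).measurable
  have hmeas : Measurable fun p : ℝ × (Fin n → ℝ) => ‖𝓕 g (auxJ n p)‖ₑ ^ 2 *
      ENNReal.ofReal ((1 + ∑ i, p.2 i ^ 2) ^ r * (1 + (p.1 ^ 2 + ∑ i, p.2 i ^ 2)) ^ s) := by
    fun_prop
  unfold hsrNormSq
  rw [← (auxJ_mp n).lintegral_comp_emb (auxJ n).measurableEmbedding]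
  simp only [auxJ_tang, auxJ_normsq, ← enorm_eq_nnnorm]
  rw [Measure.volume_eq_prod, lintegral_prod_symm _ hmeas.aemeasurable]
  refine lintegral_congr fun η => ?_
  rw [← lintegral_const_mul' _ _ ENNReal.ofReal_ne_top]
  refine lintegral_congr fun τ => ?_
  have h0 : 0 ≤ ∑ i, η i ^ 2 := Finset.sum_nonneg fun i _ => sq_nonneg _
  rw [(auxP_main hg η).2, ENNReal.ofReal_mul (by positivity), mul_left_comm,
    show 1 + (τ ^ 2 + ∑ i, η i ^ 2) = (1 + ∑ i, η i ^ 2) + τ ^ 2 by ring]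

/-- Reflection estimate (squared form): for u the restriction to ℝⁿ₊ of a Schwartz
function and f(x',xₙ) = u(x',|xₙ|), for s ∈ {0,1} and r ≥ 0 one has
‖f‖²_{H^{s,r}(ℝⁿ)} ≤ 2 ‖v‖²_{H^{s,r}(ℝⁿ)} for every extension v of u|_{ℝⁿ₊}; that is,
‖f‖_{H^{s,r}(ℝⁿ)} ≤ √2 ‖u‖_{H^{s,r}(ℝⁿ₊)} (infimum norm). -/
theorem stmt10 (n : ℕ) (s r : ℝ) (hs : s = 0 ∨ s = 1) (hr : 0 ≤ r)
    (u : SchwartzMap (EuclideanSpace ℝ (Fin (n + 1))) ℂ)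
    (v : EuclideanSpace ℝ (Fin (n + 1)) → ℂ) (hv : Integrable v)
    (hvu : ∀ x : EuclideanSpace ℝ (Fin (n + 1)), 0 < x (Fin.last n) → v x = u x) :
    hsrNormSq s r (reflectLast (fun x => u x)) ≤ 2 * hsrNormSq s r v := by
  rw [aux_norm_eq s r (aux_reflect_int u), aux_norm_eq s r hv,
    ← lintegral_const_mul' _ _ (by simp)]
  refine lintegral_mono fun η => ?_
  obtain ⟨U, hU⟩ := auxP_schwartz u η
  have h0 : 0 ≤ ∑ i, η i ^ 2 := Finset.sum_nonneg fun i _ => sq_nonneg _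
  have hF : auxP (reflectLast (fun x => u x)) η = fun t => U |t| := by
    ext t
    rw [← hU]
    simp only [auxP, auxJ_reflect]
  have hV : ∀ t, 0 < t → auxP v η t = U t := by
    intro t ht
    rw [← hU]
    simp only [auxP]
    congr 1
    ext y
    rw [hvu _ (by simpa using ht)]
  rw [hF]
  beta_reduce
  rw [mul_left_comm]
  exact mul_le_mul_right (aux_line_weighted s hs _ (by positivity) U (auxP_main hv η).1 hV) _

end
end

section
/- Let r₀ > (n-2)/2 and r ≥ 0 be real numbers. There exist constants C_{r₀} (independent of r) and C_r (increasing in r) such that for all u, v ∈ H^{1,r}(ℝⁿ) ∩ H^{1,r₀}(ℝⁿ), ‖uv‖_{H^{1,r}(ℝⁿ)} ≤ C_{r₀} ‖u‖_{H^{1,r₀}(ℝⁿ)} ‖v‖_{H^{1,r}(ℝⁿ)} + C_r ‖u‖_{H^{1,r}(ℝⁿ)} ‖v‖_{H^{1,r₀}(ℝⁿ)}. The key point is that the constant multiplying the high norm of v is independent of r. -/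
open MeasureTheory
open scoped ENNReal FourierTransform

noncomputable section

/-- H^{s,r}(ℝⁿ) norm: (∫ |û(ξ)|² (1+|ξ'|²)^r (1+|ξ|²)^s dξ)^{1/2}. -/
def hsrNorm {n : ℕ} (s r : ℝ) (u : EuclideanSpace ℝ (Fin (n + 1)) → ℂ) : ℝ≥0∞ :=
  (∫⁻ ξ, (‖𝓕 u ξ‖₊ : ℝ≥0∞) ^ 2 *
    ENNReal.ofReal ((1 + tangSq ξ) ^ r * (1 + ‖ξ‖ ^ 2) ^ s)) ^ (1 / 2 : ℝ)

section FourierPart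

variable {V : Type*} [NormedAddCommGroup V] [InnerProductSpace ℝ V] [MeasurableSpace V]
  [BorelSpace V] [FiniteDimensional ℝ V]

lemma aux_fourier_continuous {f : V → ℂ} (hf : Integrable f) : Continuous (𝓕 f) :=
  VectorFourier.fourierIntegral_continuous Real.continuous_fourierChar
    (by exact continuous_inner) hf

lemma aux_fourierInv_continuous {f : V → ℂ} (hf : Integrable f) : Continuous (𝓕⁻ f) :=
  VectorFourier.fourierIntegral_continuous Real.continuous_fourierChar
    (L := -innerₗ V) (by simpa using! continuous_inner.neg) hf

lemma aux_flip {f g : V → ℂ} (hf : Integrable f) (hg : Integrable g) :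
    ∫ ξ, 𝓕 f ξ * g ξ = ∫ x, f x * 𝓕 g x := by
  simpa using! VectorFourier.integral_fourierIntegral_smul_eq_flip (L := innerₗ V)
    Real.continuous_fourierChar continuous_inner hf hg

lemma aux_flipInv {f g : V → ℂ} (hf : Integrable f) (hg : Integrable g) :
    ∫ ξ, 𝓕⁻ f ξ * g ξ = ∫ x, f x * 𝓕⁻ g x := by
  have h := aux_flip hf hg.comp_neg
  have e : (𝓕 fun t ↦ g (-t)) = 𝓕⁻ g := (Real.fourierInv_eq_fourier_comp_neg g).symm
  rw [e] at h
  rw [← h, ← integral_neg_eq_self]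
  congr 1
  ext ξ
  rw [Real.fourierInv_eq_fourier_neg, neg_neg]

lemma aux_inversion {f : V → ℂ} (hf : Integrable f) (hF : Integrable (𝓕 f)) :
    ∀ᵐ x, f x = 𝓕⁻ (𝓕 f) x := by
  refine ae_eq_of_integral_contDiff_smul_eq hf.locallyIntegrable
    (aux_fourierInv_continuous hF).locallyIntegrable ?_
  intro g hg hgc
  have hgc' : HasCompactSupport (fun x => (g x : ℂ)) := hgc.comp_left Complex.ofReal_zero
  let G : SchwartzMap V ℂ := hgc'.toSchwartzMap (Complex.ofRealCLM.contDiff.comp hg)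
  have hG : ∀ x, G x = (g x : ℂ) := fun x => rfl
  have e1 : 𝓕 (𝓕⁻ (G : V → ℂ)) = G := by
    rw [← SchwartzMap.fourierInv_coe, ← SchwartzMap.fourier_coe]
    simp
  have hGi : Integrable (𝓕⁻ (G : V → ℂ)) := by
    rw [← SchwartzMap.fourierInv_coe]; exact SchwartzMap.integrable _
  calc ∫ x, g x • f x = ∫ x, f x * 𝓕 (𝓕⁻ (G : V → ℂ)) x := by
        rw [e1]; congr 1; ext x; rw [hG, mul_comm]; simp
    _ = ∫ x, 𝓕 f x * (𝓕⁻ (G : V → ℂ)) x := (aux_flip hf hGi).symm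
    _ = ∫ x, 𝓕⁻ (𝓕 f) x * G x := (aux_flipInv hF G.integrable).symm
    _ = _ := by congr 1; ext x; rw [hG, mul_comm]; simp

lemma aux_conv {u v : V → ℂ} (hu : Integrable u) (hv : Integrable v)
    (hF : Integrable (𝓕 u)) (ξ : V) :
    𝓕 (u * v) ξ = ∫ η, 𝓕 u η * 𝓕 v (ξ - η) := by
  have hh : Integrable (fun x => Real.fourierChar (-inner ℝ x ξ) • v x) :=
    (Real.fourierIntegral_convergent_iff ξ).2 hv
  have h1 := aux_flipInv hF hh
  rw [Real.fourier_eq]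
  have h2 : ∀ η, 𝓕⁻ (fun x => Real.fourierChar (-inner ℝ x ξ) • v x) η = 𝓕 v (ξ - η) := by
    intro η
    rw [Real.fourierInv_eq, Real.fourier_eq]
    congr 1; ext x
    rw [smul_smul, ← AddChar.map_add_eq_mul, inner_sub_right]
    congr 2; ring
  simp only [h2] at h1
  rw [← h1]
  apply integral_congr_ae
  filter_upwards [aux_inversion hu hF] with x hx
  rw [← hx, Pi.mul_apply, mul_smul_comm]

lemma aux_conv_le {u v : V → ℂ} (hu : Integrable u) (hv : Integrable v)
    (hF : Integrable (𝓕 u) ∨ Integrable (𝓕 v)) (ξ : V) :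
    ‖𝓕 (u * v) ξ‖ₑ ≤ ∫⁻ η, ‖𝓕 u η‖ₑ * ‖𝓕 v (ξ - η)‖ₑ := by
  rcases hF with hF | hF
  · rw [aux_conv hu hv hF]
    refine (enorm_integral_le_lintegral_enorm _).trans_eq ?_
    simp
  · rw [mul_comm, aux_conv hv hu hF]
    refine (enorm_integral_le_lintegral_enorm _).trans_eq ?_
    rw [← lintegral_sub_left_eq_self _ ξ]
    simp [mul_comm]

end FourierPart

section Schur

variable {V : Type*} [AddCommGroup V] [MeasurableSpace V] [MeasurableAdd₂ V] [MeasurableNeg V]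
  {μ : Measure V} [SFinite μ] [μ.IsAddLeftInvariant]

lemma aux_CS {α : Type*} [MeasurableSpace α] {ν : Measure α} {f g : α → ℝ≥0∞}
    (hf : AEMeasurable f ν) (hg : AEMeasurable g ν) :
    (∫⁻ x, f x * g x ∂ν) ^ 2 ≤ (∫⁻ x, f x ^ 2 ∂ν) * ∫⁻ x, g x ^ 2 ∂ν := by
  have h := ENNReal.lintegral_mul_le_Lp_mul_Lq ν Real.HolderConjugate.two_two hf hg
  have h2 := pow_le_pow_left₀ zero_le h 2
  rw [mul_pow, ← ENNReal.rpow_natCast, ← ENNReal.rpow_natCast, ← ENNReal.rpow_natCast,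
    ← ENNReal.rpow_mul, ← ENNReal.rpow_mul] at h2
  simpa using h2

lemma aux_schur [μ.IsNegInvariant] {a b : V → ℝ≥0∞} {K : V → V → ℝ≥0∞} {M : ℝ≥0∞}
    (ha : Measurable a) (hb : Measurable b) (hK : ∀ ξ, Measurable (K ξ))
    (hM : ∀ ξ, ∫⁻ η, K ξ η ^ 2 ∂μ ≤ M) :
    (∫⁻ ξ, (∫⁻ η, a η * b (ξ - η) * K ξ η ∂μ) ^ 2 ∂μ) ≤
      M * (∫⁻ η, a η ^ 2 ∂μ) * ∫⁻ η, b η ^ 2 ∂μ := by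
  calc (∫⁻ ξ, (∫⁻ η, a η * b (ξ - η) * K ξ η ∂μ) ^ 2 ∂μ)
      ≤ ∫⁻ ξ, (∫⁻ η, (a η * b (ξ - η)) ^ 2 ∂μ) * M ∂μ := by
        refine lintegral_mono fun ξ => ?_
        refine (aux_CS ?_ (hK ξ).aemeasurable).trans (mul_le_mul_right (hM ξ) _)
        fun_prop
    _ = (∫⁻ ξ, (∫⁻ η, a η ^ 2 * b (ξ - η) ^ 2 ∂μ) ∂μ) * M := by
        simp only [mul_pow]
        rw [lintegral_mul_const]
        fun_prop
    _ = (∫⁻ η, (∫⁻ ξ, a η ^ 2 * b (ξ - η) ^ 2 ∂μ) ∂μ) * M := by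
        rw [lintegral_lintegral_swap]
        fun_prop
    _ = (∫⁻ η, a η ^ 2 * (∫⁻ ξ, b ξ ^ 2 ∂μ) ∂μ) * M := by
        congr 2; ext η
        rw [lintegral_const_mul _ (by fun_prop)]
        rw [lintegral_sub_right_eq_self (fun x => b x ^ 2)]
    _ = _ := by
        rw [lintegral_mul_const _ (by fun_prop)]
        ring

end Schur

section Weights

variable {n : ℕ}

local notation "EE" => EuclideanSpace ℝ (Fin (n + 1))

/-- tangential projection -/
def tangP (ξ : EuclideanSpace ℝ (Fin (n + 1))) : EuclideanSpace ℝ (Fin n) :=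
  WithLp.toLp 2 (fun i => ξ (Fin.castSucc i))

lemma tangSq_eq (ξ : EE) : tangSq ξ = ‖tangP ξ‖ ^ 2 := by
  rw [EuclideanSpace.norm_sq_eq]
  simp [tangSq, tangP]

lemma tangP_add (ξ η : EE) : tangP (ξ + η) = tangP ξ + tangP η := by
  ext i; simp [tangP]

lemma tangSq_nonneg (ξ : EE) : 0 ≤ tangSq ξ := by rw [tangSq_eq]; positivity

lemma norm_sq_eq_tang (ξ : EE) : ‖ξ‖ ^ 2 = tangSq ξ + ξ (Fin.last n) ^ 2 := by
  rw [EuclideanSpace.norm_sq_eq, Fin.sum_univ_castSucc]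
  simp [tangSq]

lemma measurable_tangSq : Measurable (tangSq : EE → ℝ) := by
  unfold tangSq
  fun_prop

/-- tangential bracket -/
def jT (ξ : EuclideanSpace ℝ (Fin (n + 1))) : ℝ := √(1 + tangSq ξ)
/-- full bracket -/
def jA (ξ : EuclideanSpace ℝ (Fin (n + 1))) : ℝ := √(1 + ‖ξ‖ ^ 2)
/-- weight -/
def wt (r : ℝ) (ξ : EuclideanSpace ℝ (Fin (n + 1))) : ℝ := jT ξ ^ r * jA ξ
/-- inverse square weight -/
def qq (r : ℝ) (ξ : EuclideanSpace ℝ (Fin (n + 1))) : ℝ :=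
  ((1 + tangSq ξ) ^ r * (1 + ‖ξ‖ ^ 2))⁻¹
/-- kernel -/
def kk (r : ℝ) (η ζ : EuclideanSpace ℝ (Fin (n + 1))) : ℝ :=
  (jT η ^ r)⁻¹ * ((jA ζ)⁻¹ + (jA η)⁻¹)

lemma jT_pos (ξ : EE) : 0 < jT ξ := by
  have := tangSq_nonneg ξ
  unfold jT; positivity
lemma jA_pos (ξ : EE) : 0 < jA ξ := by unfold jA; positivity
lemma jT_sq (ξ : EE) : jT ξ ^ 2 = 1 + tangSq ξ := by
  have := tangSq_nonneg ξ
  exact Real.sq_sqrt (by positivity)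
lemma jA_sq (ξ : EE) : jA ξ ^ 2 = 1 + ‖ξ‖ ^ 2 := Real.sq_sqrt (by positivity)
lemma wt_pos (r : ℝ) (ξ : EE) : 0 < wt r ξ := by
  have := jT_pos ξ
  have := jA_pos ξ
  unfold wt; positivity
lemma kk_nonneg (r : ℝ) (ξ η : EE) : 0 ≤ kk r ξ η := by
  have := jT_pos ξ
  have := jA_pos ξ
  have := jA_pos η
  unfold kk; positivity

lemma measurable_jT : Measurable (jT : EE → ℝ) := by
  have := measurable_tangSq (n := n)
  unfold jT; fun_prop
lemma measurable_jA : Measurable (jA : EE → ℝ) := by unfold jA; fun_prop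
lemma measurable_wt (r : ℝ) : Measurable (wt r : EE → ℝ) := by
  have := measurable_jT (n := n)
  have := measurable_jA (n := n)
  unfold wt; fun_prop
lemma measurable_kk (r : ℝ) : Measurable (fun p : EE × EE => kk r p.1 p.2) := by
  have := measurable_jT (n := n)
  have := measurable_jA (n := n)
  unfold kk; fun_prop
lemma measurable_qq (r : ℝ) : Measurable (qq r : EE → ℝ) := by
  have := measurable_tangSq (n := n)
  unfold qq; fun_prop

lemma jT_rpow_sq (r : ℝ) (ξ : EE) : (jT ξ ^ r) ^ 2 = (1 + tangSq ξ) ^ r := by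
  rw [← Real.rpow_natCast, ← Real.rpow_mul (jT_pos ξ).le, mul_comm, Real.rpow_mul (jT_pos ξ).le,
    Real.rpow_natCast, jT_sq]

lemma wt_sq (r : ℝ) (ξ : EE) : wt r ξ ^ 2 = (1 + tangSq ξ) ^ r * (1 + ‖ξ‖ ^ 2) ^ (1 : ℝ) := by
  rw [wt, mul_pow, jA_sq, jT_rpow_sq, Real.rpow_one]

lemma qq_eq (r : ℝ) (ξ : EE) : qq r ξ = (wt r ξ)⁻¹ ^ 2 := by
  rw [inv_pow, wt_sq, Real.rpow_one, qq]

lemma sqrt_subadd {a b c : ℝ} (ha : 0 ≤ a) (hb : 0 ≤ b) (hc : 0 ≤ c) (h : c ≤ a + b) :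
    √(1 + c ^ 2) ≤ √(1 + a ^ 2) + √(1 + b ^ 2) := by
  have h1 : a ≤ √(1 + a ^ 2) := Real.le_sqrt_of_sq_le (by linarith)
  have h2 : b ≤ √(1 + b ^ 2) := Real.le_sqrt_of_sq_le (by linarith)
  have h3 := Real.sq_sqrt (show 0 ≤ 1 + a ^ 2 by positivity)
  have h4 := Real.sq_sqrt (show 0 ≤ 1 + b ^ 2 by positivity)
  rw [Real.sqrt_le_left (by positivity)]
  nlinarith [mul_le_mul h1 h2 hb (by positivity)]

lemma jA_add (ζ η : EE) : jA (ζ + η) ≤ jA ζ + jA η :=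
  sqrt_subadd (norm_nonneg _) (norm_nonneg _) (norm_nonneg _) (norm_add_le _ _)

lemma jT_add (ζ η : EE) : jT (ζ + η) ≤ jT ζ + jT η := by
  unfold jT
  simp only [tangSq_eq, tangP_add]
  exact sqrt_subadd (norm_nonneg _) (norm_nonneg _) (norm_nonneg _) (norm_add_le _ _)

lemma asym {a b c r : ℝ} (ha : 0 < a) (hb : 0 < b) (hc : 0 ≤ c) (h : c ≤ a + b) (hr : 0 ≤ r) :
    c ^ r ≤ 4 * a ^ r + (1 + r) ^ r * b ^ r := by
  have hp : (0 : ℝ) ≤ a ^ r := by positivity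
  have hq : (0 : ℝ) ≤ (1 + r) ^ r * b ^ r := by positivity
  rcases le_total (r * b) a with h1 | h1
  · have h2 : c ≤ a * Real.exp (b / a) := by
      have := Real.add_one_le_exp (b / a)
      calc c ≤ a * (b / a + 1) := by field_simp; linarith
        _ ≤ _ := by gcongr
    have h3 : c ^ r ≤ a ^ r * Real.exp (b / a * r) := by
      rw [Real.exp_mul, ← Real.mul_rpow ha.le (Real.exp_pos _).le]
      exact Real.rpow_le_rpow hc h2 hr
    have h4 : Real.exp (b / a * r) ≤ 4 := by
      have : b / a * r ≤ 1 := by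
        rw [div_mul_eq_mul_div, div_le_one ha]; linarith
      have := Real.exp_le_exp.2 this
      have := Real.exp_one_lt_d9
      linarith
    nlinarith [mul_le_mul_of_nonneg_left h4 hp]
  · have h2 : c ≤ (1 + r) * b := by linarith
    have h3 := Real.rpow_le_rpow hc h2 hr
    rw [Real.mul_rpow (by positivity) hb.le] at h3
    linarith

lemma wt_main {r : ℝ} (hr : 0 ≤ r) (r₀ : ℝ) (ζ η : EE) :
    wt r (ζ + η) ≤ 4 * (wt r₀ η * wt r ζ * kk r₀ η ζ) +
      (1 + r) ^ r * (wt r η * wt r₀ ζ * kk r₀ ζ η) := by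
  have a1 := jT_pos ζ
  have a2 := jT_pos η
  have a3 := jA_pos ζ
  have a4 := jA_pos η
  have e : ∀ x y : EE, wt r₀ x * wt r y * kk r₀ x y = jT y ^ r * (jA x + jA y) := by
    intro x y
    have b1 := jT_pos x
    have b2 := jA_pos x
    have b3 := jA_pos y
    have b4 : 0 < jT x ^ r₀ := by positivity
    unfold wt kk
    field_simp
  rw [e, mul_comm (wt r η), e, wt]
  calc jT (ζ + η) ^ r * jA (ζ + η)
      ≤ (4 * jT ζ ^ r + (1 + r) ^ r * jT η ^ r) * (jA ζ + jA η) := by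
        refine mul_le_mul (asym a1 a2 (jT_pos _).le (jT_add _ _) hr) (jA_add _ _)
          (jA_pos _).le (by positivity)
    _ = _ := by ring

/-- shift along the last coordinate -/
def lastE (t : ℝ) : EuclideanSpace ℝ (Fin (n + 1)) := EuclideanSpace.single (Fin.last n) t

lemma tangSq_lastE (t : ℝ) (η : EE) : tangSq (η - lastE t) = tangSq η := by
  simp [tangSq, lastE]

lemma kk_sq_le {r : ℝ} (hr : 0 ≤ r) (ξ η : EE) :
    kk r η (ξ - η) ^ 2 ≤
      2 * (qq r (ξ - η) + qq r (η - lastE (ξ (Fin.last n))) + qq r η) := by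
  have tn := tangSq_nonneg η
  have tz := tangSq_nonneg (ξ - η)
  have h0 : kk r η (ξ - η) ^ 2 ≤
      2 * (((1 + tangSq η) ^ r)⁻¹ * (1 + ‖ξ - η‖ ^ 2)⁻¹ + qq r η) := by
    unfold kk qq
    rw [mul_pow, inv_pow, jT_rpow_sq, ← jA_sq, ← jA_sq, mul_inv, ← mul_add, mul_left_comm]
    refine mul_le_mul_of_nonneg_left ?_ (by positivity)
    rw [← inv_pow, ← inv_pow]
    nlinarith [sq_nonneg ((jA (ξ - η))⁻¹ - (jA η)⁻¹)]
  have q1 : 0 ≤ qq r (ξ - η) := by unfold qq; positivity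
  have q2 : 0 ≤ qq r (η - lastE (ξ (Fin.last n))) := by
    unfold qq; rw [tangSq_lastE]; positivity
  refine h0.trans ?_
  suffices h : ((1 + tangSq η) ^ r)⁻¹ * (1 + ‖ξ - η‖ ^ 2)⁻¹ ≤
      qq r (ξ - η) + qq r (η - lastE (ξ (Fin.last n))) by linarith
  rcases le_total (tangSq (ξ - η)) (tangSq η) with h | h
  · have : ((1 + tangSq η) ^ r)⁻¹ * (1 + ‖ξ - η‖ ^ 2)⁻¹ ≤ qq r (ξ - η) := by
      unfold qq; rw [mul_inv]; gcongr
    linarith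
  · have : ((1 + tangSq η) ^ r)⁻¹ * (1 + ‖ξ - η‖ ^ 2)⁻¹ ≤ qq r (η - lastE (ξ (Fin.last n))) := by
      unfold qq
      rw [tangSq_lastE, mul_inv]
      gcongr ?_ * ?_
      refine inv_anti₀ (by positivity) ?_
      rw [norm_sq_eq_tang, norm_sq_eq_tang, tangSq_lastE]
      simp only [lastE, PiLp.sub_apply, PiLp.single_apply, if_true]
      nlinarith
    linarith

lemma qq_integrable {r : ℝ} (hr : 0 ≤ r) (hr₀ : ((n : ℝ) + 1 - 2) / 2 < r) :
    Integrable (qq r : EE → ℝ) := by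
  obtain ⟨θ, h1, h2⟩ : ∃ θ : ℝ, 1 / 2 < θ ∧ θ < min 1 (r + 1 - n / 2) :=
    exists_between (lt_min (by norm_num) (by linarith))
  obtain ⟨h2, h3⟩ := lt_min_iff.1 h2
  have i1 : Integrable (fun x : ℝ => (1 + ‖x‖ ^ 2) ^ (-(2 * θ) / 2)) :=
    integrable_rpow_neg_one_add_norm_sq (by simp; linarith)
  have i2 : Integrable (fun x : EuclideanSpace ℝ (Fin n) =>
      (1 + ‖x‖ ^ 2) ^ (-(2 * (r + 1 - θ)) / 2)) :=
    integrable_rpow_neg_one_add_norm_sq (by simp; linarith)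
  have mp : MeasurePreserving (fun ξ : EE => (ξ (Fin.last n), tangP ξ)) volume
      ((volume : Measure ℝ).prod (volume : Measure (EuclideanSpace ℝ (Fin n)))) := by
    have m1 := PiLp.volume_preserving_ofLp (Fin (n + 1))
    have m2 := volume_preserving_piFinSuccAbove (fun _ : Fin (n + 1) => ℝ) (Fin.last n)
    have m3 := (MeasurePreserving.id (volume : Measure ℝ)).prod
      (PiLp.volume_preserving_toLp (Fin n))
    have m4 := (m3.comp m2).comp m1
    have heq : (fun ξ : EE => (ξ (Fin.last n), tangP ξ)) = (Prod.map id (WithLp.toLp 2) ∘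
        ⇑(MeasurableEquiv.piFinSuccAbove (fun _ : Fin (n + 1) => ℝ) (Fin.last n))) ∘
          WithLp.ofLp := by
      funext ξ
      refine Prod.ext rfl ?_
      ext i
      simp [tangP, MeasurableEquiv.piFinSuccAbove, Fin.insertNthEquiv, Fin.init]
    rw [heq]
    exact m4
  have i3 := mp.integrable_comp_of_integrable (i1.mul_prod i2)
  refine i3.mono' (measurable_qq r).aestronglyMeasurable (Filter.Eventually.of_forall fun ξ => ?_)
  have tn := tangSq_nonneg ξ
  have hq : 0 ≤ qq r ξ := by unfold qq; positivity
  rw [Real.norm_of_nonneg hq]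
  simp only [Function.comp, ← tangSq_eq]
  rw [Real.norm_eq_abs, sq_abs, qq, mul_inv,
    show -(2 * θ) / 2 = -θ by ring, show -(2 * (r + 1 - θ)) / 2 = -r + -(1 - θ) by ring,
    Real.rpow_add (by positivity), Real.rpow_neg (by positivity) r]
  have hk : (1 + ‖ξ‖ ^ 2)⁻¹ = (1 + ‖ξ‖ ^ 2) ^ (-θ) * (1 + ‖ξ‖ ^ 2) ^ (-(1 - θ)) := by
    rw [← Real.rpow_add (by positivity), ← Real.rpow_neg_one]; congr 1; ring
  have k1 : (1 + ‖ξ‖ ^ 2) ^ (-θ) ≤ (1 + ξ (Fin.last n) ^ 2) ^ (-θ) :=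
    Real.rpow_le_rpow_of_nonpos (by positivity) (by rw [norm_sq_eq_tang]; linarith) (by linarith)
  have k2 : (1 + ‖ξ‖ ^ 2) ^ (-(1 - θ)) ≤ (1 + tangSq ξ) ^ (-(1 - θ)) :=
    Real.rpow_le_rpow_of_nonpos (by positivity)
      (by rw [norm_sq_eq_tang]; nlinarith [sq_nonneg (ξ (Fin.last n))]) (by linarith)
  calc _ ≤ ((1 + tangSq ξ) ^ r)⁻¹ *
        ((1 + ξ (Fin.last n) ^ 2) ^ (-θ) * (1 + tangSq ξ) ^ (-(1 - θ))) := by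
        rw [hk]; gcongr
    _ = _ := by ring

/-- total mass -/
def II (n : ℕ) (r : ℝ) : ℝ≥0∞ :=
  ∫⁻ ξ : EuclideanSpace ℝ (Fin (n + 1)), ENNReal.ofReal (qq r ξ)

lemma II_ne_top {r : ℝ} (hr : 0 ≤ r) (hr₀ : ((n : ℝ) + 1 - 2) / 2 < r) : II n r ≠ ⊤ :=
  (qq_integrable (n := n) hr hr₀).lintegral_lt_top.ne

lemma qq_nonneg (r : ℝ) (ξ : EE) : 0 ≤ qq r ξ := by rw [qq_eq]; positivity

lemma kernel_bound {r : ℝ} (hr : 0 ≤ r) (ξ : EE) :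
    ∫⁻ η, ENNReal.ofReal (kk r η (ξ - η)) ^ 2 ≤ 6 * II n r := by
  have mq := measurable_qq (n := n) r
  calc ∫⁻ η, ENNReal.ofReal (kk r η (ξ - η)) ^ 2
      ≤ ∫⁻ η, 2 * (ENNReal.ofReal (qq r (ξ - η)) +
          ENNReal.ofReal (qq r (η - lastE (ξ (Fin.last n)))) + ENNReal.ofReal (qq r η)) := by
        refine lintegral_mono fun η => ?_
        rw [← ENNReal.ofReal_pow (kk_nonneg _ _ _), ← ENNReal.ofReal_add, ← ENNReal.ofReal_add]
        · refine (ENNReal.ofReal_le_ofReal (kk_sq_le hr ξ η)).trans_eq ?_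
          rw [ENNReal.ofReal_mul (by norm_num)]; simp
        all_goals first | exact qq_nonneg _ _ | exact add_nonneg (qq_nonneg _ _) (qq_nonneg _ _)
    _ = _ := by
        rw [lintegral_const_mul _ (by fun_prop), lintegral_add_right _ (by fun_prop),
          lintegral_add_right _ (by fun_prop),
          lintegral_sub_left_eq_self (fun x => ENNReal.ofReal (qq r x)),
          lintegral_sub_right_eq_self (fun x => ENNReal.ofReal (qq r x))]
        change 2 * (II n r + II n r + II n r) = _
        ring

lemma kernel_bound' {r : ℝ} (hr : 0 ≤ r) (ξ : EE) :
    ∫⁻ η, ENNReal.ofReal (kk r (ξ - η) η) ^ 2 ≤ 6 * II n r := by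
  rw [← lintegral_sub_left_eq_self _ ξ]
  simpa using kernel_bound hr ξ

end Weights

section Main

variable {n : ℕ}

local notation "EE" => EuclideanSpace ℝ (Fin (n + 1))

lemma hsrNorm_eq (r : ℝ) (u : EE → ℂ) :
    hsrNorm 1 r u = (∫⁻ ξ, (‖𝓕 u ξ‖ₑ * ENNReal.ofReal (wt r ξ)) ^ 2) ^ (1 / 2 : ℝ) := by
  unfold hsrNorm
  congr 2
  ext ξ
  rw [mul_pow, ← ENNReal.ofReal_pow (wt_pos r ξ).le, wt_sq]
  rfl

lemma integrable_of_norm {r : ℝ} (hI : II n r ≠ ⊤) {u : EE → ℂ} (hu : Integrable u)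
    (h : hsrNorm 1 r u ≠ ⊤) : Integrable (𝓕 u) := by
  have hc := aux_fourier_continuous hu
  have mw := measurable_wt (n := n) r
  refine ⟨hc.aestronglyMeasurable, ?_⟩
  rw [hsrNorm_eq] at h
  have h' : (∫⁻ ξ, (‖𝓕 u ξ‖ₑ * ENNReal.ofReal (wt r ξ)) ^ 2) ≠ ⊤ := by
    intro h2; rw [h2] at h; simp at h
  have hcs := aux_CS (ν := volume) (f := fun ξ => ‖𝓕 u ξ‖ₑ * ENNReal.ofReal (wt r ξ))
    (g := fun ξ : EE => ENNReal.ofReal (wt r ξ)⁻¹)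
    (hc.enorm.measurable.mul mw.ennreal_ofReal).aemeasurable (by fun_prop)
  have e1 : ∀ ξ, ‖𝓕 u ξ‖ₑ * ENNReal.ofReal (wt r ξ) * ENNReal.ofReal (wt r ξ)⁻¹ = ‖𝓕 u ξ‖ₑ := by
    intro ξ
    have := wt_pos r ξ
    rw [mul_assoc, ← ENNReal.ofReal_mul this.le, mul_inv_cancel₀ this.ne']; simp
  have e2 : ∀ ξ : EE, ENNReal.ofReal (wt r ξ)⁻¹ ^ 2 = ENNReal.ofReal (qq r ξ) := by
    intro ξ
    rw [qq_eq, ENNReal.ofReal_pow (inv_nonneg.2 (wt_pos r ξ).le)]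
  simp only [e1, e2] at hcs
  have := hcs.trans_lt (ENNReal.mul_lt_top h'.lt_top hI.lt_top)
  simpa [HasFiniteIntegral] using this

lemma integrable_of_norm_zero {r : ℝ} {u : EE → ℂ} (hu : Integrable u)
    (h : hsrNorm 1 r u = 0) : Integrable (𝓕 u) := by
  have hc := aux_fourier_continuous hu
  have mw := measurable_wt (n := n) r
  rw [hsrNorm_eq, ENNReal.rpow_eq_zero_iff_of_pos (by norm_num), lintegral_eq_zero_iff] at h
  · have : 𝓕 u =ᵐ[volume] 0 := by
      filter_upwards [h] with ξ hξ
      have := wt_pos r ξ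
      simpa [this.not_ge] using hξ
    exact (integrable_congr this).2 (integrable_zero _ _ _)
  · exact (hc.enorm.measurable.mul mw.ennreal_ofReal).pow_const 2

lemma sqrt_three {M a b : ℝ≥0∞} : (M * a * b) ^ (1 / 2 : ℝ) =
    M ^ (1 / 2 : ℝ) * a ^ (1 / 2 : ℝ) * b ^ (1 / 2 : ℝ) := by
  rw [ENNReal.mul_rpow_of_nonneg _ _ (by norm_num), ENNReal.mul_rpow_of_nonneg _ _ (by norm_num)]

lemma sqrt_const {c : ℝ≥0∞} {f : EE → ℝ≥0∞} (hf : Measurable f) :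
    (∫⁻ x, (c * f x) ^ 2) ^ (1 / 2 : ℝ) = c * (∫⁻ x, f x ^ 2) ^ (1 / 2 : ℝ) := by
  simp only [mul_pow]
  rw [lintegral_const_mul _ (by fun_prop), ENNReal.mul_rpow_of_nonneg _ _ (by norm_num)]
  congr 1
  rw [← ENNReal.rpow_natCast, ← ENNReal.rpow_mul]
  norm_num

lemma minkowski {f g : EE → ℝ≥0∞} (hf : Measurable f) (hg : Measurable g) :
    (∫⁻ x, (f x + g x) ^ 2) ^ (1 / 2 : ℝ) ≤
      (∫⁻ x, f x ^ 2) ^ (1 / 2 : ℝ) + (∫⁻ x, g x ^ 2) ^ (1 / 2 : ℝ) := by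
  have := ENNReal.lintegral_Lp_add_le (μ := volume) hf.aemeasurable hg.aemeasurable
    (p := 2) (by norm_num)
  simpa using this

lemma schurP {r₀ : ℝ} (hr₀ : 0 ≤ r₀) {a b : EE → ℝ≥0∞} (ha : Measurable a) (hb : Measurable b) :
    (∫⁻ ξ, (∫⁻ η, a η * b (ξ - η) * ENNReal.ofReal (kk r₀ η (ξ - η))) ^ 2) ^ (1 / 2 : ℝ) ≤
      (6 * II n r₀) ^ (1 / 2 : ℝ) * (∫⁻ η, a η ^ 2) ^ (1 / 2 : ℝ) *
        (∫⁻ η, b η ^ 2) ^ (1 / 2 : ℝ) := by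
  rw [← sqrt_three]
  refine ENNReal.rpow_le_rpow ?_ (by norm_num)
  refine aux_schur (μ := (volume : Measure EE))
    (K := fun ξ η => ENNReal.ofReal (kk r₀ η (ξ - η))) ha hb ?_ (kernel_bound hr₀)
  intro ξ
  exact ((measurable_kk r₀).comp
    (measurable_id.prodMk (measurable_const.sub measurable_id))).ennreal_ofReal

lemma schurQ {r₀ : ℝ} (hr₀ : 0 ≤ r₀) {a b : EE → ℝ≥0∞} (ha : Measurable a) (hb : Measurable b) :
    (∫⁻ ξ, (∫⁻ η, a η * b (ξ - η) * ENNReal.ofReal (kk r₀ (ξ - η) η)) ^ 2) ^ (1 / 2 : ℝ) ≤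
      (6 * II n r₀) ^ (1 / 2 : ℝ) * (∫⁻ η, a η ^ 2) ^ (1 / 2 : ℝ) *
        (∫⁻ η, b η ^ 2) ^ (1 / 2 : ℝ) := by
  rw [← sqrt_three]
  refine ENNReal.rpow_le_rpow ?_ (by norm_num)
  refine aux_schur (μ := (volume : Measure EE))
    (K := fun ξ η => ENNReal.ofReal (kk r₀ (ξ - η) η)) ha hb ?_ (kernel_bound' hr₀)
  intro ξ
  exact ((measurable_kk r₀).comp
    ((measurable_const.sub measurable_id).prodMk measurable_id)).ennreal_ofReal

lemma measP' {r₀ : ℝ} {a b : EE → ℝ≥0∞} (ha : Measurable a) (hb : Measurable b) :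
    Measurable (fun p : EE × EE => a p.2 * b (p.1 - p.2) *
      ENNReal.ofReal (kk r₀ p.2 (p.1 - p.2))) :=
  ((ha.comp measurable_snd).mul (hb.comp (measurable_fst.sub measurable_snd))).mul
    ((measurable_kk r₀).comp
      (measurable_snd.prodMk (measurable_fst.sub measurable_snd))).ennreal_ofReal

lemma measQ' {r₀ : ℝ} {a b : EE → ℝ≥0∞} (ha : Measurable a) (hb : Measurable b) :
    Measurable (fun p : EE × EE => a p.2 * b (p.1 - p.2) *
      ENNReal.ofReal (kk r₀ (p.1 - p.2) p.2)) :=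
  ((ha.comp measurable_snd).mul (hb.comp (measurable_fst.sub measurable_snd))).mul
    ((measurable_kk r₀).comp
      ((measurable_fst.sub measurable_snd).prodMk measurable_snd)).ennreal_ofReal

lemma ptwise {r r₀ : ℝ} (hr : 0 ≤ r) (f g : EE → ℝ≥0∞) (ξ η : EE) :
    f η * g (ξ - η) * ENNReal.ofReal (wt r ξ) ≤
      4 * (f η * ENNReal.ofReal (wt r₀ η) * (g (ξ - η) * ENNReal.ofReal (wt r (ξ - η))) *
        ENNReal.ofReal (kk r₀ η (ξ - η))) +
      ENNReal.ofReal ((1 + r) ^ r) *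
        (f η * ENNReal.ofReal (wt r η) * (g (ξ - η) * ENNReal.ofReal (wt r₀ (ξ - η))) *
        ENNReal.ofReal (kk r₀ (ξ - η) η)) := by
  have h := wt_main hr r₀ (ξ - η) η
  rw [sub_add_cancel] at h
  have h2 := ENNReal.ofReal_le_ofReal h
  have w1 := fun s => (wt_pos s η).le
  have w2 := fun s => (wt_pos s (ξ - η)).le
  have w3 := kk_nonneg r₀ η (ξ - η)
  have w4 := kk_nonneg r₀ (ξ - η) η
  have w5 : 0 ≤ (1 + r) ^ r := by positivity
  rw [ENNReal.ofReal_add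
      (mul_nonneg (by norm_num) (mul_nonneg (mul_nonneg (w1 _) (w2 _)) w3))
      (mul_nonneg w5 (mul_nonneg (mul_nonneg (w1 _) (w2 _)) w4)),
    ENNReal.ofReal_mul (by norm_num), ENNReal.ofReal_mul w5,
    ENNReal.ofReal_mul (mul_nonneg (w1 _) (w2 _)),
    ENNReal.ofReal_mul (mul_nonneg (w1 _) (w2 _)),
    ENNReal.ofReal_mul (w1 _), ENNReal.ofReal_mul (w1 _),
    show ENNReal.ofReal 4 = 4 by simp] at h2
  refine (mul_le_mul_right h2 _).trans_eq ?_
  ring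

lemma abs_est {r r₀ : ℝ} (hr : 0 ≤ r) (hr₀ : 0 ≤ r₀) {f g h : EE → ℝ≥0∞}
    (mf : Measurable f) (mg : Measurable g) (hh : ∀ ξ, h ξ ≤ ∫⁻ η, f η * g (ξ - η)) :
    (∫⁻ ξ, (h ξ * ENNReal.ofReal (wt r ξ)) ^ 2) ^ (1 / 2 : ℝ) ≤
      4 * ((6 * II n r₀) ^ (1 / 2 : ℝ) *
        (∫⁻ ξ, (f ξ * ENNReal.ofReal (wt r₀ ξ)) ^ 2) ^ (1 / 2 : ℝ) *
        (∫⁻ ξ, (g ξ * ENNReal.ofReal (wt r ξ)) ^ 2) ^ (1 / 2 : ℝ)) +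
      ENNReal.ofReal ((1 + r) ^ r) * ((6 * II n r₀) ^ (1 / 2 : ℝ) *
        (∫⁻ ξ, (f ξ * ENNReal.ofReal (wt r ξ)) ^ 2) ^ (1 / 2 : ℝ) *
        (∫⁻ ξ, (g ξ * ENNReal.ofReal (wt r₀ ξ)) ^ 2) ^ (1 / 2 : ℝ)) := by
  have mA : ∀ s, Measurable (fun ξ => f ξ * ENNReal.ofReal (wt s ξ)) :=
    fun s => mf.mul (measurable_wt s).ennreal_ofReal
  have mB : ∀ s, Measurable (fun ξ => g ξ * ENNReal.ofReal (wt s ξ)) :=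
    fun s => mg.mul (measurable_wt s).ennreal_ofReal
  have hP := schurP hr₀ (mA r₀) (mB r)
  have hQ := schurQ hr₀ (mA r) (mB r₀)
  have mP' := measP' (r₀ := r₀) (mA r₀) (mB r)
  have mQ' := measQ' (r₀ := r₀) (mA r) (mB r₀)
  have mP := mP'.lintegral_prod_right' (ν := (volume : Measure EE))
  have mQ := mQ'.lintegral_prod_right' (ν := (volume : Measure EE))
  have hmono := fun ξ => lintegral_mono (μ := (volume : Measure EE)) (ptwise (r₀ := r₀) hr f g ξ)
  have key : ∀ ξ, h ξ * ENNReal.ofReal (wt r ξ) ≤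
      4 * (∫⁻ η, f η * ENNReal.ofReal (wt r₀ η) * (g (ξ - η) * ENNReal.ofReal (wt r (ξ - η))) *
        ENNReal.ofReal (kk r₀ η (ξ - η))) + ENNReal.ofReal ((1 + r) ^ r) *
        (∫⁻ η, f η * ENNReal.ofReal (wt r η) * (g (ξ - η) * ENNReal.ofReal (wt r₀ (ξ - η))) *
        ENNReal.ofReal (kk r₀ (ξ - η) η)) := by
    intro ξ
    have m1 := mP'.comp (measurable_const.prodMk measurable_id : Measurable fun η : EE => (ξ, η))
    have m2 := mQ'.comp (measurable_const.prodMk measurable_id : Measurable fun η : EE => (ξ, η))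
    simp only [Function.comp_def] at m1 m2
    have h1 := hmono ξ
    have m0 : Measurable (fun η => f η * g (ξ - η)) := by fun_prop
    rw [lintegral_mul_const _ m0,
      lintegral_add_left (m1.const_mul _), lintegral_const_mul _ m1,
      lintegral_const_mul _ m2] at h1
    exact le_trans (mul_le_mul_left (hh ξ) _) h1
  refine le_trans (ENNReal.rpow_le_rpow
    (lintegral_mono fun ξ => pow_le_pow_left₀ zero_le (key ξ) 2) (by norm_num)) ?_
  refine (minkowski (mP.const_mul _) (mQ.const_mul _)).trans ?_
  rw [sqrt_const mP, sqrt_const mQ]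
  exact add_le_add (mul_le_mul_right hP _) (mul_le_mul_right hQ _)

lemma main_est {r r₀ : ℝ} (hr : 0 ≤ r) (hr₀ : 0 ≤ r₀) {u v : EE → ℂ}
    (hu : Integrable u) (hv : Integrable v) (hF : Integrable (𝓕 u) ∨ Integrable (𝓕 v)) :
    hsrNorm 1 r (u * v) ≤
      4 * ((6 * II n r₀) ^ (1 / 2 : ℝ) * hsrNorm 1 r₀ u * hsrNorm 1 r v) +
      ENNReal.ofReal ((1 + r) ^ r) *
        ((6 * II n r₀) ^ (1 / 2 : ℝ) * hsrNorm 1 r u * hsrNorm 1 r₀ v) := by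
  have mu : Measurable (fun ξ => ‖𝓕 u ξ‖ₑ) := (aux_fourier_continuous hu).enorm.measurable
  have mv : Measurable (fun ξ => ‖𝓕 v ξ‖ₑ) := (aux_fourier_continuous hv).enorm.measurable
  simp only [hsrNorm_eq]
  exact abs_est (h := fun ξ => ‖𝓕 (u * v) ξ‖ₑ) hr hr₀ mu mv (aux_conv_le hu hv hF)

lemma main_nonneg (n : ℕ) (r₀ : ℝ) (h0 : 0 ≤ r₀) (hr₀ : ((n : ℝ) + 1 - 2) / 2 < r₀) :
    ∃ C₀ : ℝ, 0 < C₀ ∧ ∃ C : ℝ → ℝ, MonotoneOn C (Set.Ici 0) ∧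
      ∀ r : ℝ, 0 ≤ r →
        ∀ u v : EuclideanSpace ℝ (Fin (n + 1)) → ℂ,
          Integrable u → Integrable v → Integrable (u * v) →
          hsrNorm 1 r (u * v) ≤
            ENNReal.ofReal C₀ * hsrNorm 1 r₀ u * hsrNorm 1 r v +
              ENNReal.ofReal (C r) * hsrNorm 1 r u * hsrNorm 1 r₀ v := by
  have hI := II_ne_top (n := n) h0 hr₀
  have hM : (6 * II n r₀) ^ (1 / 2 : ℝ) ≠ ⊤ :=
    ENNReal.rpow_ne_top_of_nonneg (by norm_num) (ENNReal.mul_ne_top (by simp) hI)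
  set m : ℝ := ((6 * II n r₀) ^ (1 / 2 : ℝ)).toReal + 1 with hm
  have mpos : 0 < m := by positivity
  have hle : (6 * II n r₀) ^ (1 / 2 : ℝ) ≤ ENNReal.ofReal m := by
    rw [ENNReal.le_ofReal_iff_toReal_le hM mpos.le]; linarith
  refine ⟨4 * m, by positivity, fun r => (1 + r) ^ r * m, ?_, ?_⟩
  · intro a ha b hb hab
    have ha' : (0 : ℝ) ≤ a := ha
    have hb' : (0 : ℝ) ≤ b := hb
    refine mul_le_mul_of_nonneg_right ?_ mpos.le
    calc (1 + a) ^ a ≤ (1 + b) ^ a := Real.rpow_le_rpow (by positivity) (by linarith) ha'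
      _ ≤ (1 + b) ^ b := Real.rpow_le_rpow_of_exponent_le (by linarith) hab
  intro r hr u v hu hv _
  by_cases hF : Integrable (𝓕 u) ∨ Integrable (𝓕 v)
  · refine (main_est hr h0 hu hv hF).trans ?_
    rw [ENNReal.ofReal_mul (by norm_num), ENNReal.ofReal_mul (by positivity),
      show ENNReal.ofReal 4 = 4 by simp]
    simp only [mul_assoc]
    gcongr
  · push Not at hF
    have h1 : hsrNorm 1 r₀ u = ⊤ := by
      by_contra h; exact hF.1 (integrable_of_norm hI hu h)
    have h2 : hsrNorm 1 r v ≠ 0 := fun h => hF.2 (integrable_of_norm_zero hv h)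
    have h3 : ENNReal.ofReal (4 * m) ≠ 0 := by
      simp [mpos]
    rw [h1, ENNReal.mul_top h3, ENNReal.top_mul h2, top_add]
    exact le_top

end Main

/-- Asymmetric tame product estimate in H^{1,r}(ℝⁿ): for r₀ > (n-2)/2 there is a
constant C₀ (independent of r) and constants C_r increasing in r such that
‖uv‖_{H^{1,r}} ≤ C₀ ‖u‖_{H^{1,r₀}} ‖v‖_{H^{1,r}} + C_r ‖u‖_{H^{1,r}} ‖v‖_{H^{1,r₀}}
for all r ≥ 0 and all u, v ∈ H^{1,r} ∩ H^{1,r₀}. -/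
theorem stmt13 (n : ℕ) (r₀ : ℝ) (hr₀ : ((n : ℝ) + 1 - 2) / 2 < r₀) :
    ∃ C₀ : ℝ, 0 < C₀ ∧ ∃ C : ℝ → ℝ, MonotoneOn C (Set.Ici 0) ∧
      ∀ r : ℝ, 0 ≤ r →
        ∀ u v : EuclideanSpace ℝ (Fin (n + 1)) → ℂ,
          Integrable u → Integrable v → Integrable (u * v) →
          hsrNorm 1 r (u * v) ≤
            ENNReal.ofReal C₀ * hsrNorm 1 r₀ u * hsrNorm 1 r v +
              ENNReal.ofReal (C r) * hsrNorm 1 r u * hsrNorm 1 r₀ v := by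
  rcases le_or_gt 0 r₀ with h0 | h0
  · exact main_nonneg n r₀ h0 hr₀
  · have hn : n = 0 := by
      have : (n : ℝ) < 1 := by linarith
      exact_mod_cast Nat.lt_one_iff.1 (by exact_mod_cast this)
    subst hn
    have e : ∀ u : EuclideanSpace ℝ (Fin (0 + 1)) → ℂ, hsrNorm 1 r₀ u = hsrNorm 1 0 u := by
      intro u
      simp [hsrNorm, tangSq]
    simp only [e]
    exact main_nonneg 0 0 le_rfl (by norm_num)

end
end
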